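/- arXiv:1002.2116 — 4 statements merged into one kernel-verified Lean document; each statement's English description precedes it below -/
import Mathlib

section
/- Let A be a commutative ring and R = A[t₁,…,tₙ] a polynomial ring. Let K = ⋀_R^•(Rⁿ) be the Koszul complex of the sequence (t₁,…,tₙ), with differential δ = ι(t₁e₁* + … + tₙeₙ*) given by contraction, where (e₁,…,eₙ) is the standard basis of Rⁿ and (e₁*,…,eₙ*) the dual basis. Define the A-submodule C = Σ_{i₁<…<i_k, k≥1} R_{≥i₁}·e_{i₁}∧…∧e_{i_k} of K, where R_{≥i} = A[t_i, t_{i+1},…,tₙ] ⊆ R. Then K decomposes as a direct sum of A-modules: K = ker(δ) ⊕ C. -/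
/-!
STATEMENT 0.
`K = ⋀_R^•(Rⁿ)` over `R = A[t₁,…,tₙ]` is modeled as the free `R`-module
`Finset (Fin n) → R` with basis `e_S = e_{i₁} ∧ … ∧ e_{i_k}` for `S = {i₁ < … < i_k}`.
The Koszul differential is the contraction `δ = ι(∑ⱼ tⱼ eⱼ*)`, which on basis elements acts by
`δ(e_S) = ∑_{j ∈ S} (-1)^{#{i ∈ S : i < j}} tⱼ e_{S \ {j}}`; equivalently, on coefficient
functions `(δφ)(S) = ∑_{j ∉ S} (-1)^{#{i ∈ S : i < j}} tⱼ · φ(S ∪ {j})`.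
`C` is the `A`-submodule of elements whose coefficient at `∅` is `0` and whose coefficient at a
nonempty `S` lies in `R_{≥ min S} = A[t_{min S},…,tₙ]`.
The theorem: `K = ker δ ⊕ C` as `A`-modules, i.e. `ker δ` and `C` are complementary
`A`-submodules.
-/

noncomputable def koszulDelta (n : ℕ) (A : Type*) [CommRing A] :
    (Finset (Fin n) → MvPolynomial (Fin n) A) →ₗ[A]
      (Finset (Fin n) → MvPolynomial (Fin n) A) where
  toFun φ := fun S => ∑ j : Fin n, if j ∉ S then
      ((-1 : MvPolynomial (Fin n) A) ^ (S.filter (fun i => i < j)).card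
        * MvPolynomial.X j) * φ (insert j S)
    else 0
  map_add' φ ψ := by
    funext S
    rw [Pi.add_apply, ← Finset.sum_add_distrib]
    refine Finset.sum_congr rfl fun j _ => ?_
    by_cases h : j ∈ S <;> simp [h, mul_add]
  map_smul' a φ := by
    funext S
    simp only [RingHom.id_apply, Pi.smul_apply, Finset.smul_sum]
    refine Finset.sum_congr rfl fun j _ => ?_
    by_cases h : j ∈ S <;> simp [h, mul_smul_comm]

/-- The `A`-submodule `C = ∑_{S ≠ ∅} R_{≥ min S} · e_S`, where
`R_{≥ i} = A[tᵢ,…,tₙ]` is the subalgebra of polynomials in the variables of index `≥ i`. -/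
noncomputable def koszulC (n : ℕ) (A : Type*) [CommRing A] :
    Submodule A (Finset (Fin n) → MvPolynomial (Fin n) A) where
  carrier := {φ | φ ∅ = 0 ∧ ∀ (S : Finset (Fin n)) (hS : S.Nonempty),
      φ S ∈ MvPolynomial.supported A {j : Fin n | S.min' hS ≤ j}}
  add_mem' := by
    rintro φ ψ ⟨h1, h2⟩ ⟨g1, g2⟩
    exact ⟨by simp [h1, g1], fun S hS => add_mem (h2 S hS) (g2 S hS)⟩
  zero_mem' := ⟨rfl, fun S hS => zero_mem _⟩
  smul_mem' := by
    rintro a φ ⟨h1, h2⟩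
    refine ⟨by simp [h1], fun S hS => ?_⟩
    simpa using Subalgebra.smul_mem _ (h2 S hS) a

theorem koszulDelta_apply {n : ℕ} {A : Type*} [CommRing A]
    (φ : Finset (Fin n) → MvPolynomial (Fin n) A) (S : Finset (Fin n)) :
    koszulDelta n A φ S = ∑ j : Fin n, if j ∉ S then
      ((-1 : MvPolynomial (Fin n) A) ^ (S.filter (fun i => i < j)).card
        * MvPolynomial.X j) * φ (insert j S) else 0 := rfl

theorem mem_koszulC {n : ℕ} {A : Type*} [CommRing A]
    {φ : Finset (Fin n) → MvPolynomial (Fin n) A} :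
    φ ∈ koszulC n A ↔ φ ∅ = 0 ∧ ∀ (S : Finset (Fin n)) (hS : S.Nonempty),
      φ S ∈ MvPolynomial.supported A {j : Fin n | S.min' hS ≤ j} := Iff.rfl

/-- An element supported, as a function on finsets, in sets `S` containing an `i` such that all
variables and all elements of `S` are at least `i`, lies in `C`. -/
theorem mem_koszulC_of_forall {n : ℕ} {A : Type*} [CommRing A]
    {φ : Finset (Fin n) → MvPolynomial (Fin n) A} (i : Fin n)
    (h : ∀ S, φ S ≠ 0 → i ∈ S ∧ φ S ∈ MvPolynomial.supported A (Set.Ici i)) :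
    φ ∈ koszulC n A := by
  refine mem_koszulC.2 ⟨?_, fun S hS => ?_⟩
  · by_contra h0
    simpa using (h ∅ h0).1
  · by_cases h0 : φ S = 0
    · rw [h0]
      exact zero_mem _
    · obtain ⟨hi, hφ⟩ := h S h0
      exact MvPolynomial.supported_mono
        (fun j (hj : i ≤ j) => (S.min'_le i hi).trans hj) hφ

theorem coeff_eq_zero_of_mem_supported {σ A : Type*} [CommRing A] {s : Set σ}
    {p : MvPolynomial σ A} (hp : p ∈ MvPolynomial.supported A s) {m : σ →₀ ℕ} {i : σ}
    (hi : i ∉ s) (hm : m i ≠ 0) : p.coeff m = 0 := by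
  by_contra h
  exact hi (MvPolynomial.mem_supported.1 hp ((MvPolynomial.mem_vars_iff_mem_support i).2
    ⟨m, MvPolynomial.mem_support_iff.2 h, Finsupp.mem_support_iff.2 hm⟩))

theorem monomial_mem_supported {σ A : Type*} [CommRing A] {s : Set σ} {m : σ →₀ ℕ}
    (hm : ∀ i, m i ≠ 0 → i ∈ s) (a : A) :
    MvPolynomial.monomial m a ∈ MvPolynomial.supported A s := by
  refine MvPolynomial.mem_supported.2 fun i hi => ?_
  obtain ⟨d, hd, hid⟩ := (MvPolynomial.mem_vars_iff_mem_support i).1 hi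
  have := Finset.mem_singleton.1 (MvPolynomial.support_monomial_subset hd)
  subst this
  exact hm i (Finsupp.mem_support_iff.1 hid)

theorem X_mem_supported_of_mem {σ A : Type*} [CommRing A] {s : Set σ} {i : σ} (hi : i ∈ s) :
    (MvPolynomial.X i : MvPolynomial σ A) ∈ MvPolynomial.supported A s :=
  Algebra.subset_adjoin (Set.mem_image_of_mem _ hi)

/-- The Koszul differential squares to zero. -/
theorem koszulDelta_koszulDelta {n : ℕ} {A : Type*} [CommRing A]
    (φ : Finset (Fin n) → MvPolynomial (Fin n) A) :
    koszulDelta n A (koszulDelta n A φ) = 0 := by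
  have sign_insert (S : Finset (Fin n)) (j k : Fin n) (hj : j ∉ S) :
      ((insert j S).filter (· < k)).card = (S.filter (· < k)).card + if j < k then 1 else 0 := by
    rw [Finset.filter_insert]
    split_ifs <;> simp [hj]
  let term (S : Finset (Fin n)) (j k : Fin n) : MvPolynomial (Fin n) A :=
    if j ∉ S ∧ k ∉ insert j S then
      (-1) ^ (S.filter (· < j)).card * MvPolynomial.X j *
        ((-1) ^ ((insert j S).filter (· < k)).card * MvPolynomial.X k *
          φ (insert k (insert j S)))
    else 0
  have term_swap (S : Finset (Fin n)) (j k : Fin n) : term S j k + term S k j = 0 := by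
    by_cases h : j ∉ S ∧ k ∉ insert j S
    · have h' : k ∉ S ∧ j ∉ insert k S := by grind
      simp only [term, if_pos h, if_pos h', sign_insert S j k h.1, sign_insert S k j h'.1,
        Finset.insert_comm j k S]
      rcases lt_or_gt_of_ne (show j ≠ k by grind) with hjk | hjk
      · simp only [hjk, hjk.not_gt, if_true, if_false]
        ring
      · simp only [hjk, hjk.not_gt, if_true, if_false]
        ring
    · have h' : ¬ (k ∉ S ∧ j ∉ insert k S) := by grind
      simp only [term, if_neg h, if_neg h', add_zero]
  funext S
  have expand : koszulDelta n A (koszulDelta n A φ) S =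
      ∑ p : Fin n × Fin n, term S p.1 p.2 := by
    rw [Fintype.sum_prod_type, koszulDelta_apply]
    refine Finset.sum_congr rfl fun j _ => ?_
    by_cases hj : j ∈ S
    · simp [term, hj]
    · rw [if_pos hj, koszulDelta_apply, Finset.mul_sum]
      refine Finset.sum_congr rfl fun k _ => ?_
      by_cases hk : k ∈ insert j S
      · simp only [term, hk, not_true, and_false, if_false, mul_zero]
      · simp only [term, hk, hj, not_false_eq_true, and_self, if_true]
  rw [expand]
  refine Finset.sum_involution (fun p _ => p.swap) (fun p _ => term_swap S p.1 p.2) ?_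
    (fun _ _ => Finset.mem_univ _) (fun p _ => p.swap_swap)
  rintro ⟨j, k⟩ - hne heq
  obtain rfl : k = j := congrArg Prod.fst heq
  simp [term] at hne

/-- The kernel of the Koszul differential meets `C` trivially. -/
theorem eq_zero_of_mem_koszulC_of_koszulDelta_eq_zero {n : ℕ} {A : Type*} [CommRing A]
    {φ : Finset (Fin n) → MvPolynomial (Fin n) A} (hC : φ ∈ koszulC n A)
    (hδ : koszulDelta n A φ = 0) : φ = 0 := by
  obtain ⟨h0, hsupp⟩ := mem_koszulC.1 hC
  funext S
  rcases S.eq_empty_or_nonempty with rfl | hS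
  · exact h0
  ext m
  rw [Pi.zero_apply, MvPolynomial.coeff_zero]
  set i := S.min' hS
  have hiS : i ∈ S := S.min'_mem hS
  by_cases hm : ∃ j < i, m j ≠ 0
  · obtain ⟨j, hj, hmj⟩ := hm
    exact coeff_eq_zero_of_mem_supported (hsupp S hS) (i := j) hj.not_ge hmj
  push Not at hm
  have hsum := congrArg (MvPolynomial.coeff (m + Finsupp.single i 1))
    (congrFun hδ (S.erase i))
  rw [koszulDelta_apply, Pi.zero_apply, MvPolynomial.coeff_zero, MvPolynomial.coeff_sum,
    Finset.sum_eq_single i] at hsum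
  · have hsign : (S.erase i).filter (· < i) = ∅ :=
      Finset.filter_eq_empty_iff.2 fun {j} hj =>
        (S.min'_le j (Finset.mem_of_mem_erase hj)).not_gt
    rwa [if_pos (Finset.notMem_erase i S), hsign, Finset.card_empty, pow_zero, one_mul,
      Finset.insert_erase hiS, add_comm, MvPolynomial.coeff_X_mul] at hsum
  · intro j _ hji
    split_ifs with hj
    · exact MvPolynomial.coeff_zero _
    rw [mul_assoc, ← map_one MvPolynomial.C, ← map_neg, ← map_pow, MvPolynomial.coeff_C_mul]
    rcases lt_or_gt_of_ne hji with hlt | hgt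
    · rw [MvPolynomial.coeff_X_mul', if_neg, mul_zero]
      simp [hm j hlt, hlt.ne]
    · have hmin : MvPolynomial.X j * φ (insert j (S.erase i)) ∈
          MvPolynomial.supported A (Set.Ioi i) := by
        refine mul_mem (X_mem_supported_of_mem hgt)
          (MvPolynomial.supported_mono ?_ (hsupp _ (Finset.insert_nonempty _ _)))
        refine fun k hk => Set.mem_Ioi.2 <| lt_of_lt_of_le ((Finset.lt_min'_iff _ _).2 fun l hl => ?_) hk
        rcases Finset.mem_insert.1 hl with rfl | hl
        · exact hgt
        · exact lt_of_le_of_ne (S.min'_le l (Finset.mem_of_mem_erase hl))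
            (Finset.ne_of_mem_erase hl).symm
      rw [coeff_eq_zero_of_mem_supported hmin (i := i) (by simp) (by simp), mul_zero]
  · simp

/-- Every `a t^m e_S` lies in `ker δ + C`. -/
theorem single_monomial_mem_ker_sup_koszulC {n : ℕ} {A : Type*} [CommRing A]
    (S : Finset (Fin n)) (m : Fin n →₀ ℕ) (a : A) :
    Pi.single S (MvPolynomial.monomial m a) ∈
      LinearMap.ker (koszulDelta n A) ⊔ koszulC n A := by
  rcases (m.support ∪ S).eq_empty_or_nonempty with hempty | hne
  · obtain ⟨-, rfl⟩ := Finset.union_eq_empty.1 hempty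
    refine Submodule.mem_sup_left (LinearMap.mem_ker.2 (funext fun T => ?_))
    rw [koszulDelta_apply]
    refine Finset.sum_eq_zero fun j _ => ?_
    simp
  set i := (m.support ∪ S).min' hne with hi
  have hmi : ∀ j, m j ≠ 0 → i ≤ j := fun j hj =>
    Finset.min'_le _ _ (Finset.mem_union_left _ (Finsupp.mem_support_iff.2 hj))
  have hSi : ∀ j ∈ S, i ≤ j := fun j hj => Finset.min'_le _ _ (Finset.mem_union_right _ hj)
  by_cases hiS : i ∈ S
  · refine Submodule.mem_sup_right (mem_koszulC_of_forall i fun T hT => ?_)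
    obtain rfl : T = S := by
      by_contra h
      exact hT (Pi.single_eq_of_ne h _)
    rw [Pi.single_eq_same]
    exact ⟨hiS, monomial_mem_supported hmi a⟩
  have him : m i ≠ 0 := by
    have := (m.support ∪ S).min'_mem hne
    rw [← hi, Finset.mem_union, Finsupp.mem_support_iff] at this
    exact this.resolve_right hiS
  have hle : Finsupp.single i 1 ≤ m := by
    simpa [Finsupp.single_le_iff] using Nat.one_le_iff_ne_zero.2 him
  set q : MvPolynomial (Fin n) A := MvPolynomial.monomial (m - Finsupp.single i 1) a with hq
  have hXq : MvPolynomial.X i * q = MvPolynomial.monomial m a := by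
    rw [hq, MvPolynomial.X, MvPolynomial.monomial_mul, one_mul, add_tsub_cancel_of_le hle]
  have hqi : q ∈ MvPolynomial.supported A (Set.Ici i) :=
    monomial_mem_supported (fun j hj => hmi j fun h => hj (by simp [h])) a
  set y : Finset (Fin n) → MvPolynomial (Fin n) A := Pi.single (insert i S) q with hy
  have hyS : koszulDelta n A y S = MvPolynomial.monomial m a := by
    have hsign : S.filter (· < i) = ∅ :=
      Finset.filter_eq_empty_iff.2 fun {j} hj => (hSi j hj).not_gt
    rw [koszulDelta_apply, Finset.sum_eq_single i]
    · rw [if_pos hiS, hsign, hy, Pi.single_eq_same, Finset.card_empty, pow_zero, one_mul, hXq]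
    · intro j _ hji
      split_ifs with hj
      · rfl
      · rw [hy, Pi.single_eq_of_ne (mt (Finset.insert_inj hj).1 hji), mul_zero]
    · simp
  rw [← add_sub_cancel (koszulDelta n A y) (Pi.single S (MvPolynomial.monomial m a))]
  refine Submodule.add_mem_sup (LinearMap.mem_ker.2 (koszulDelta_koszulDelta y))
    (mem_koszulC_of_forall i fun T hT => ?_)
  rw [Pi.sub_apply] at hT ⊢
  have hTS : T ≠ S := by
    rintro rfl
    exact hT (by rw [Pi.single_eq_same, hyS, sub_self])
  rw [Pi.single_eq_of_ne hTS, zero_sub] at hT ⊢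
  rw [neg_ne_zero] at hT
  refine ⟨?_, neg_mem ?_⟩
  · rw [koszulDelta_apply] at hT
    obtain ⟨j, -, hj⟩ := Finset.exists_ne_zero_of_sum_ne_zero hT
    by_contra hiT
    refine hj ?_
    split_ifs with hjT
    · rfl
    · rw [hy, Pi.single_eq_of_ne, mul_zero]
      intro h
      have hij : i ∈ insert j T := h ▸ Finset.mem_insert_self i S
      obtain rfl : i = j := (Finset.mem_insert.1 hij).resolve_right hiT
      exact hTS (by rw [← Finset.erase_insert hiT, h, Finset.erase_insert hiS])
  · rw [koszulDelta_apply]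
    refine sum_mem fun j _ => ?_
    split_ifs with hjT
    · exact zero_mem _
    · by_cases hins : insert j T = insert i S
      · have hij : i ≤ j := by
          rcases Finset.mem_insert.1 (hins ▸ Finset.mem_insert_self j T) with h | h
          · exact h.ge
          · exact hSi j h
        rw [hins, hy, Pi.single_eq_same]
        exact mul_mem (mul_mem (pow_mem (neg_mem (one_mem _)) _)
          (X_mem_supported_of_mem hij)) hqi
      · rw [hy, Pi.single_eq_of_ne hins, mul_zero]
        exact zero_mem _

/-- Lemma on Koszul complexes: `K = ker δ ⊕ C` as `A`-modules. -/
theorem koszul_kernel_complement (n : ℕ) (A : Type*) [CommRing A] :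
    IsCompl (LinearMap.ker (koszulDelta n A)) (koszulC n A) := by
  refine ⟨Submodule.disjoint_def.2 fun φ hφ hC =>
    eq_zero_of_mem_koszulC_of_koszulDelta_eq_zero hC hφ, codisjoint_iff.2 ?_⟩
  refine Submodule.eq_top_iff'.2 fun φ => ?_
  rw [← Finset.univ_sum_single φ]
  refine sum_mem fun S _ => ?_
  induction φ S using MvPolynomial.induction_on' with
  | monomial m a => exact single_monomial_mem_ker_sup_koszulC S m a
  | add p q hp hq =>
    rw [Pi.single_add]
    exact add_mem hp hq
end

section
/- Let k be a field, V a k-vector space with basis e₁,…,eₙ, R a commutative k-algebra, and K = ⋀^•(V) ⊗ₖ R, which is a finitely generated free R-module with ℤ/2-grading induced by exterior degree mod 2. Suppose A₁,…,A_r are R-linear operators on K such that for each i, either Aᵢ = ι(e_m*) (contraction with a dual basis vector) for some m, or Aᵢ = (Σⱼ eⱼ ⊗ fⱼ) ∧ ? (left exterior multiplication) for some f₁,…,fₙ ∈ R. If there exists an index i ∈ {1,…,n} such that ι(eᵢ*) does not appear among A₁,…,A_r, then str_R(A₁∘…∘A_r) = 0. -/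
/-!
STATEMENT 2.
`K = ⋀^•(V) ⊗ₖ R` with `V = kⁿ` is modeled as the free `R`-module `Finset (Fin n) → R`
with basis `e_S = e_{i₁} ∧ … ∧ e_{i_k}` for `S = {i₁ < … < i_k}`; ℤ/2-grading by `S.card % 2`.
`extContr u` is the contraction `ι(∑ⱼ uⱼ eⱼ*)` and `extWedge v` is the left exterior
multiplication `(∑ⱼ eⱼ ⊗ vⱼ) ∧ ?`; `ι(e_m*) = extContr (Pi.single m 1)`.
`extStr` is the supertrace `str_R = tr on even part − tr on odd part`, computed in the basis.
If some `ι(eᵢ*)` does not appear among the operators `A₁,…,A_r`, the supertrace of the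
composition `A₁ ∘ … ∘ A_r` vanishes.
-/

noncomputable section

variable {R : Type*} [CommRing R] {n : ℕ}

/-- Contraction `ι(∑ⱼ uⱼ eⱼ*)` on `K = ⋀^•(kⁿ) ⊗ R`. -/
def extContr (u : Fin n → R) (φ : Finset (Fin n) → R) : Finset (Fin n) → R :=
  fun S => ∑ j : Fin n, if j ∉ S then
    ((-1 : R) ^ (S.filter (fun i => i < j)).card * u j) * φ (insert j S)
  else 0

/-- Left exterior multiplication `(∑ⱼ eⱼ ⊗ vⱼ) ∧ ?` on `K = ⋀^•(kⁿ) ⊗ R`. -/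
def extWedge (v : Fin n → R) (φ : Finset (Fin n) → R) : Finset (Fin n) → R :=
  fun S => ∑ j : Fin n, if j ∈ S then
    ((-1 : R) ^ ((S.erase j).filter (fun i => i < j)).card * v j) * φ (S.erase j)
  else 0

/-- Supertrace of an operator on `K = ⋀^•(kⁿ) ⊗ R`, graded by exterior degree mod 2. -/
def extStr (A : (Finset (Fin n) → R) → (Finset (Fin n) → R)) : R :=
  ∑ S : Finset (Fin n), (-1 : R) ^ S.card * A (fun T => if T = S then 1 else 0) S

/-- Right exterior multiplication `? ∧ eᵢ` on `K = ⋀^•(kⁿ) ⊗ R`. -/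
def extRightWedge (i : Fin n) (φ : Finset (Fin n) → R) : Finset (Fin n) → R :=
  fun S => if i ∈ S then (-1 : R) ^ ((S.erase i).filter (fun j => i < j)).card * φ (S.erase i)
  else 0

lemma neg_one_pow_card_filter_insert {α : Type*} [DecidableEq α] (p : α → Prop)
    [DecidablePred p] {a : α} {T : Finset α} (ha : a ∉ T) :
    (-1 : R) ^ ((insert a T).filter p).card =
      (if p a then -1 else 1) * (-1 : R) ^ (T.filter p).card := by
  rw [Finset.filter_insert]
  split_ifs with h
  · rw [Finset.card_insert_of_notMem (by simp [ha]), pow_succ']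
  · rw [one_mul]

lemma extWedge_extRightWedge (v : Fin n → R) (i : Fin n) (φ : Finset (Fin n) → R) :
    extWedge v (extRightWedge i φ) = extRightWedge i (extWedge v φ) := by
  funext S
  simp only [extWedge, extRightWedge]
  by_cases hi : i ∈ S
  · rw [if_pos hi, Finset.mul_sum]
    refine Finset.sum_congr rfl fun j _ => ?_
    by_cases hji : j = i
    · subst hji
      simp
    by_cases hj : j ∈ S
    · obtain ⟨T, hiT, hjT, rfl⟩ : ∃ T, i ∉ T ∧ j ∉ T ∧ S = insert i (insert j T) :=
        ⟨(S.erase i).erase j, by simp, by simp, by grind⟩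
      have h₁ : (insert i (insert j T)).erase i = insert j T := by grind
      have h₂ : (insert i (insert j T)).erase j = insert i T := by grind
      rw [h₁, h₂, Finset.erase_insert hiT, Finset.erase_insert hjT,
        neg_one_pow_card_filter_insert _ hiT, neg_one_pow_card_filter_insert _ hjT]
      simp only [Finset.mem_insert, true_or, or_true, if_true]
      ring
    · simp [hj]
  · rw [if_neg hi]
    refine Finset.sum_eq_zero fun j _ => ?_
    simp [hi]

lemma extContr_extRightWedge {u : Fin n → R} {i : Fin n} (hu : u i = 0)
    (φ : Finset (Fin n) → R) :
    extContr u (extRightWedge i φ) = extRightWedge i (extContr u φ) := by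
  funext S
  simp only [extContr, extRightWedge]
  by_cases hi : i ∈ S
  · rw [if_pos hi, Finset.mul_sum]
    refine Finset.sum_congr rfl fun j _ => ?_
    by_cases hji : j = i
    · subst hji
      simp [hu]
    by_cases hj : j ∈ S
    · simp [hj, hji]
    · obtain ⟨T, hiT, rfl⟩ : ∃ T, i ∉ T ∧ S = insert i T :=
        ⟨S.erase i, by simp, by grind⟩
      have hjT : j ∉ T := by grind
      have h₁ : (insert j (insert i T)).erase i = insert j T := by grind
      rw [h₁, Finset.erase_insert hiT,
        neg_one_pow_card_filter_insert _ hiT, neg_one_pow_card_filter_insert _ hjT]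
      simp only [Finset.mem_insert, hji, hjT, or_false, true_or, or_true, if_true,
        not_false_eq_true]
      split_ifs <;> ring
  · rw [if_neg hi]
    refine Finset.sum_eq_zero fun j _ => ?_
    by_cases hji : j = i
    · subst hji
      simp [hu]
    · simp [hi, Ne.symm hji]

lemma extWedge_smul (v : Fin n → R) (c : R) (φ : Finset (Fin n) → R) :
    extWedge v (c • φ) = c • extWedge v φ := by
  funext S
  simp only [extWedge, Pi.smul_apply, smul_eq_mul, Finset.mul_sum, mul_ite, mul_zero,
    mul_left_comm c]

lemma extContr_smul (u : Fin n → R) (c : R) (φ : Finset (Fin n) → R) :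
    extContr u (c • φ) = c • extContr u φ := by
  funext S
  simp only [extContr, Pi.smul_apply, smul_eq_mul, Finset.mul_sum, mul_ite, mul_zero,
    mul_left_comm c]

/-- The supertrace of a homogeneous operator commuting with `? ∧ eᵢ` vanishes: its diagonal
entries at `S` and `S ∪ {i}` agree. -/
lemma extStr_eq_zero_of_commute {B : (Finset (Fin n) → R) → (Finset (Fin n) → R)} {i : Fin n}
    (hsmul : ∀ (c : R) φ, B (c • φ) = c • B φ)
    (hcomm : ∀ φ, B (extRightWedge i φ) = extRightWedge i (B φ)) : extStr B = 0 := by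
  have key : ∀ T : Finset (Fin n), i ∉ T →
      B (fun U => if U = insert i T then 1 else 0) (insert i T) =
        B (fun U => if U = T then 1 else 0) T := by
    intro T hT
    have hbasis : extRightWedge i (fun U => if U = T then (1 : R) else 0) =
        (-1 : R) ^ (T.filter (fun j => i < j)).card •
          (fun U => if U = insert i T then (1 : R) else 0) := by
      funext U
      simp only [extRightWedge, Pi.smul_apply, smul_eq_mul]
      by_cases hU : U = insert i T
      · subst hU
        simp [Finset.erase_insert hT]
      · have : i ∈ U → U.erase i ≠ T := by grind
        split_ifs <;> simp_all
    have h := congrFun (hcomm fun U => if U = T then 1 else 0) (insert i T)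
    rw [hbasis, hsmul] at h
    simp only [extRightWedge, Pi.smul_apply, smul_eq_mul, Finset.mem_insert_self, if_true,
      Finset.erase_insert hT] at h
    exact (isUnit_one.neg.pow _).mul_left_cancel h
  refine Finset.sum_involution (fun S _ => if i ∈ S then S.erase i else insert i S)
    ?_ ?_ (fun _ _ => Finset.mem_univ _) ?_
  · intro S _
    by_cases hi : i ∈ S
    · obtain ⟨T, hT, rfl⟩ : ∃ T, i ∉ T ∧ S = insert i T := ⟨S.erase i, by simp, by grind⟩
      simp only [hi, if_true, Finset.erase_insert hT, key T hT, Finset.card_insert_of_notMem hT]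
      ring
    · simp only [hi, if_false, key S hi, Finset.card_insert_of_notMem hi]
      ring
  · grind
  · grind

/-- Lemma `exterior-tr-lem`. -/
theorem supertrace_vanishes_without_all_contractions
    (k : Type*) [Field k] [Algebra k R] (n r : ℕ)
    (A : Fin r → ((Finset (Fin n) → R) → (Finset (Fin n) → R)))
    (hA : ∀ i : Fin r, (∃ m : Fin n, A i = extContr (Pi.single m 1)) ∨
      (∃ f : Fin n → R, A i = extWedge f))
    (i₀ : Fin n) (hmiss : ∀ j : Fin r, A j ≠ extContr (Pi.single i₀ (1 : R))) :
    extStr ((List.ofFn A).foldr (· ∘ ·) id) = 0 := by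
  have hfold : ∀ L : List ((Finset (Fin n) → R) → (Finset (Fin n) → R)),
      (∀ B ∈ L, (∀ (c : R) φ, B (c • φ) = c • B φ) ∧
        ∀ φ, B (extRightWedge i₀ φ) = extRightWedge i₀ (B φ)) →
      (∀ (c : R) φ, L.foldr (· ∘ ·) id (c • φ) = c • L.foldr (· ∘ ·) id φ) ∧
        ∀ φ, L.foldr (· ∘ ·) id (extRightWedge i₀ φ) =
          extRightWedge i₀ (L.foldr (· ∘ ·) id φ) := by
    intro L hL
    induction L with
    | nil => simp
    | cons B L ih =>
      obtain ⟨h₁, h₂⟩ := hL B (by simp)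
      obtain ⟨h₃, h₄⟩ := ih fun C hC => hL C (by simp [hC])
      simp only [List.foldr_cons, Function.comp_apply]
      exact ⟨fun c φ => by rw [h₃, h₁], fun φ => by rw [h₄, h₂]⟩
  obtain ⟨hsmul, hcomm⟩ := hfold (List.ofFn A) (by
    intro B hB
    obtain ⟨j, rfl⟩ := List.mem_ofFn.mp hB
    rcases hA j with ⟨m, hm⟩ | ⟨f, hf⟩
    · have hne : i₀ ≠ m := by
        rintro rfl
        exact hmiss j hm
      rw [hm]
      exact ⟨extContr_smul _, extContr_extRightWedge (Pi.single_eq_of_ne hne _)⟩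
    · rw [hf]
      exact ⟨extWedge_smul f, extWedge_extRightWedge f i₀⟩)
  exact extStr_eq_zero_of_commute hsmul hcomm

end
end

section
/- Let L be a field and f₁,…,fₙ ∈ L[x₁,…,xₙ] polynomials. For a polynomial f, let Δⱼf ∈ L[x₁,…,xₙ,y₁,…,yₙ] denote the j-th difference derivative, the unique polynomial with (yⱼ−xⱼ)·Δⱼf = f(x₁,…,x_{j−1},yⱼ,y_{j+1},…,yₙ) − f(x₁,…,x_{j−1},xⱼ,y_{j+1},…,yₙ). Let p, q ∈ Lⁿ be two distinct points such that fᵢ(p) = fᵢ(q) for all i = 1,…,n. Then the n×n matrix with entries Δⱼfᵢ evaluated at (x,y) = (p,q) is degenerate: det(Δⱼfᵢ(p,q)) = 0. -/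
/-!
STATEMENT 8.
Work in `L[x₁,…,xₙ,y₁,…,yₙ] = MvPolynomial (Fin n ⊕ Fin n) L` with `x_i = X (inl i)`,
`y_i = X (inr i)`.  For `t : ℕ`, `mixedVars t` renames the variables of a polynomial in
`x₁,…,xₙ` so that the first `t` of them stay `x` and the remaining ones become `y`; thus
`rename (mixedVars (j-1)) f = f(x₁,…,x_{j−1},yⱼ,…,yₙ)` (in `1`-indexed notation).
`D i j` is the difference derivative `Δⱼfᵢ`, characterized by
`(yⱼ−xⱼ)·Δⱼfᵢ = fᵢ(x₁,…,x_{j−1},yⱼ,…,yₙ) − fᵢ(x₁,…,xⱼ,y_{j+1},…,yₙ)`.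
If `p ≠ q` and `fᵢ(p) = fᵢ(q)` for all `i`, then `det(Δⱼfᵢ(p,q)) = 0`.
-/

/-- Keep the first `t` variables as `x` (left), send the rest to `y` (right). -/
def mixedVars {n : ℕ} (t : ℕ) : Fin n → Fin n ⊕ Fin n :=
  fun i => if (i : ℕ) < t then Sum.inl i else Sum.inr i

/-- Difference derivatives satisfy `∑ j, (y_j - x_j) * Δ_j f = f(y) - f(x)`. -/
theorem sum_sub_mul_eval {L : Type*} [CommRing L] {n : ℕ}
    (f : MvPolynomial (Fin n) L) (D : Fin n → MvPolynomial (Fin n ⊕ Fin n) L)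
    (hD : ∀ j : Fin n,
      (MvPolynomial.X (Sum.inr j) - MvPolynomial.X (Sum.inl j)) * D j =
        MvPolynomial.rename (mixedVars (j : ℕ)) f
          - MvPolynomial.rename (mixedVars ((j : ℕ) + 1)) f)
    (p q : Fin n → L) :
    ∑ j, (q j - p j) * MvPolynomial.eval (Sum.elim p q) (D j) =
      MvPolynomial.eval q f - MvPolynomial.eval p f := by
  let g : ℕ → L := fun t =>
    MvPolynomial.eval (Sum.elim p q) (MvPolynomial.rename (mixedVars t) f)
  have hterm (j : Fin n) :
      (q j - p j) * MvPolynomial.eval (Sum.elim p q) (D j) = g j - g (j + 1) := by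
    simpa only [map_mul, map_sub, MvPolynomial.eval_X, Sum.elim_inl, Sum.elim_inr] using
      congrArg (MvPolynomial.eval (Sum.elim p q)) (hD j)
  have hzero : Sum.elim p q ∘ mixedVars 0 = q := by
    funext i
    simp [mixedVars]
  have hlast : Sum.elim p q ∘ mixedVars n = p := by
    funext i
    simp [mixedVars]
  rw [Finset.sum_congr rfl fun j _ => hterm j,
    Fin.sum_univ_eq_sum_range (fun t => g t - g (t + 1)) n, Finset.sum_range_sub']
  simp only [g, MvPolynomial.eval_rename, hzero, hlast]

/-- degeneracy of the difference-derivative matrix at pairs of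
distinct common points. -/
theorem difference_derivative_matrix_degenerate
    (L : Type*) [Field L] (n : ℕ)
    (f : Fin n → MvPolynomial (Fin n) L)
    (D : Fin n → Fin n → MvPolynomial (Fin n ⊕ Fin n) L)
    (hD : ∀ i j : Fin n,
      (MvPolynomial.X (Sum.inr j) - MvPolynomial.X (Sum.inl j)) * D i j =
        MvPolynomial.rename (mixedVars (j : ℕ)) (f i)
          - MvPolynomial.rename (mixedVars ((j : ℕ) + 1)) (f i))
    (p q : Fin n → L) (hpq : p ≠ q)
    (hval : ∀ i, MvPolynomial.eval p (f i) = MvPolynomial.eval q (f i)) :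
    (Matrix.of fun i j => MvPolynomial.eval (Sum.elim p q) (D i j)).det = 0 := by
  have hker : (Matrix.of fun i j => MvPolynomial.eval (Sum.elim p q) (D i j)).mulVec (q - p)
      = 0 := by
    funext i
    simpa [Matrix.mulVec, dotProduct, mul_comm, hval i] using sum_sub_mul_eval (f i) (D i) (hD i) p q
  exact Matrix.exists_mulVec_eq_zero_iff.mp ⟨q - p, sub_ne_zero.mpr hpq.symm, hker⟩
end

section
/- Let R be a commutative ring and a, b ∈ R such that w = ab is not a zero divisor in R. Let {a,b} denote the matrix factorization of w with E⁰ = E¹ = R, δ₀ = multiplication by a, δ₁ = multiplication by b, and let (Hom({a,b},{a,b}), d) be its ℤ/2-graded endomorphism complex with differential df = δ∘f − (−1)^{|f|} f∘δ. Then the even cohomology of this complex is isomorphic as an R-module to R/(Ra + Rb). -/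
/-!
STATEMENT 9.
The matrix factorization `{a,b}` of `w = ab` has `E⁰ = E¹ = R`, `δ₀ = a·`, `δ₁ = b·`.
An even endomorphism is a pair `(f₀, f₁) ∈ R × R` (`f₀ : E⁰→E⁰`, `f₁ : E¹→E¹`), and an odd
endomorphism is a pair `(u, v) ∈ R × R` (`u : E⁰→E¹`, `v : E¹→E⁰`).
The differential `df = δ∘f − (−1)^{|f|} f∘δ` becomes
`dEven (f₀,f₁) = (a(f₀−f₁), b(f₁−f₀))` (components `E⁰→E¹`, `E¹→E⁰`) and
`dOdd (u,v) = (bu+av, av+bu)` (components `E⁰→E⁰`, `E¹→E¹`).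
Even cohomology = `ker dEven / im dOdd ≅ R/(Ra+Rb)` when `ab` is not a zero divisor.
-/

noncomputable def dEven (R : Type*) [CommRing R] (a b : R) : (R × R) →ₗ[R] (R × R) where
  toFun f := (a * (f.1 - f.2), b * (f.2 - f.1))
  map_add' f g := by simp [Prod.ext_iff]; constructor <;> ring
  map_smul' r f := by simp [Prod.ext_iff]; constructor <;> ring

noncomputable def dOdd (R : Type*) [CommRing R] (a b : R) : (R × R) →ₗ[R] (R × R) where
  toFun g := (b * g.1 + a * g.2, a * g.2 + b * g.1)
  map_add' f g := by simp [Prod.ext_iff]; constructor <;> ring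
  map_smul' r f := by simp [Prod.ext_iff]; constructor <;> ring

theorem fst_eq_snd_of_mem_ker_dEven {R : Type*} [CommRing R] {a b : R}
    (ha : a ∈ nonZeroDivisors R) {f : R × R} (hf : f ∈ LinearMap.ker (dEven R a b)) :
    f.1 = f.2 := by
  have h : a * (f.1 - f.2) = 0 := congrArg Prod.fst (LinearMap.mem_ker.mp hf)
  exact sub_eq_zero.mp ((mul_left_mem_nonZeroDivisors_eq_zero_iff ha).mp h)

theorem mem_range_dOdd_iff {R : Type*} [CommRing R] {a b : R} {f : R × R} :
    f ∈ LinearMap.range (dOdd R a b) ↔ f.1 = f.2 ∧ f.1 ∈ Ideal.span {a, b} := by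
  rw [Ideal.mem_span_pair]
  constructor
  · rintro ⟨g, rfl⟩
    exact ⟨add_comm _ _, g.2, g.1, by simp only [dOdd, LinearMap.coe_mk, AddHom.coe_mk]; ring⟩
  · rintro ⟨h, x, y, hxy⟩
    refine ⟨(y, x), Prod.ext ?_ ?_⟩
    · simp only [dOdd, LinearMap.coe_mk, AddHom.coe_mk]
      rw [← hxy]; ring
    · simp only [dOdd, LinearMap.coe_mk, AddHom.coe_mk]
      rw [← h, ← hxy]; ring

/-- formula `(ab-hom)`, even part:
`Hom⁰({a,b},{a,b}) ≅ R/(Ra+Rb)` provided `ab` is not a zero divisor. -/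
theorem even_cohomology_of_ab
    (R : Type*) [CommRing R] (a b : R)
    (hw : a * b ∈ nonZeroDivisors R) :
    Nonempty
      ((↥(LinearMap.ker (dEven R a b)) ⧸
          (LinearMap.range (dOdd R a b)).comap (LinearMap.ker (dEven R a b)).subtype)
        ≃ₗ[R] (R ⧸ Ideal.span {a, b})) := by
  have ha : a ∈ nonZeroDivisors R := (mul_mem_nonZeroDivisors.mp hw).1
  let π : ↥(LinearMap.ker (dEven R a b)) →ₗ[R] (R ⧸ Ideal.span {a, b}) :=
    (Ideal.span {a, b}).mkQ ∘ₗ LinearMap.fst R R R ∘ₗ (LinearMap.ker (dEven R a b)).subtype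
  have hπ : Function.Surjective π := by
    intro y
    obtain ⟨r, rfl⟩ := Submodule.mkQ_surjective _ y
    exact ⟨⟨(r, r), by simp [dEven]⟩, rfl⟩
  have hker : (LinearMap.range (dOdd R a b)).comap (LinearMap.ker (dEven R a b)).subtype =
      LinearMap.ker π := by
    ext f
    rw [Submodule.mem_comap, mem_range_dOdd_iff, LinearMap.mem_ker]
    exact (and_iff_right (fst_eq_snd_of_mem_ker_dEven ha f.2)).trans
      (Submodule.Quotient.mk_eq_zero _).symm
  exact ⟨(Submodule.quotEquivOfEq _ _ hker).trans (π.quotKerEquivOfSurjective hπ)⟩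
end
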